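/- Let α and β be standard Borel spaces, let P be a probability measure on α × β, and let κ be a Markov kernel from α to β. Then for every probability measure γ on α, KL(P ‖ P.fst ⊗ κ) ≤ KL(P ‖ γ ⊗ κ). In other words, among all measures of the form γ ⊗ κ with κ fixed, the one with γ equal to the first marginal of P minimizes the Kullback–Leibler divergence from P. (Variational characterization of the reciprocal projection onto the factorized reciprocal class.) -/

import Mathlib

open MeasureTheory ProbabilityTheory
open scoped Classical

/-- Kullback–Leibler divergence: `∫ log (dμ/dν) dμ` when `μ ≪ ν` (and the
log-likelihood ratio is integrable), `+∞` otherwise. -/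
noncomputable def KL {Ω : Type*} [MeasurableSpace Ω] (μ ν : Measure Ω) : EReal :=
  if μ ≪ ν ∧ Integrable (llr μ ν) μ then ((∫ x, llr μ ν x ∂μ : ℝ) : EReal) else ⊤

lemma KL_eq_klDiv {Ω : Type*} [MeasurableSpace Ω] (μ ν : Measure Ω)
    [IsProbabilityMeasure μ] [IsProbabilityMeasure ν] :
    KL μ ν = ((InformationTheory.klDiv μ ν : ENNReal) : EReal) := by
  unfold KL
  split_ifs with h
  · rw [← InformationTheory.toReal_klDiv_of_measure_eq h.1 (by simp)]
    exact EReal.coe_ennreal_toReal (InformationTheory.klDiv_ne_top h.1 h.2)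
  · rw [InformationTheory.klDiv_eq_top_iff.2 (fun h1 h2 => h ⟨h1, h2⟩)]
    rfl

/-- Variational characterization of the reciprocal projection onto the
factorized reciprocal class: among all measures of the form `γ ⊗ₘ κ` with the
Markov kernel `κ` fixed, the one built from the first marginal of `P`
minimizes the Kullback–Leibler divergence from `P`. -/
theorem kl_reciprocal_projection_min {α β : Type*}
    [MeasurableSpace α] [MeasurableSpace β]
    [StandardBorelSpace α] [StandardBorelSpace β]
    (P : Measure (α × β)) [IsProbabilityMeasure P]
    (κ : Kernel α β) [IsMarkovKernel κ] :
    ∀ γ : Measure α, IsProbabilityMeasure γ →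
      KL P (P.fst ⊗ₘ κ) ≤ KL P (γ ⊗ₘ κ) := by
  intro γ hγ
  have : Nonempty (α × β) := P.nonempty_of_neZero
  have : Nonempty β := this.map Prod.snd
  rw [KL_eq_klDiv, KL_eq_klDiv, EReal.coe_ennreal_le_coe_ennreal_iff]
  have h := InformationTheory.klDiv_compProd_eq_add (μ := P.fst) (ν := γ)
    (κ := P.condKernel) (η := κ)
  rw [P.disintegrate P.condKernel] at h
  rw [h]
  exact le_add_self
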